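/- (Lower energy bound for arbitrary signals.) Let A ∈ ℂ^{m×d} satisfy the restricted isometry property with parameters (s, δ) for some s ≥ 1 and 0 ≤ δ < 1. Then for every x ∈ ℂ^d, ‖Ax‖₂ ≥ √(1 − δ) ‖x_s‖₂ − √(1 + δ) ( ‖x − x_s‖₂ + ‖x − x_s‖₁/√s ). -/

import Mathlib

open scoped BigOperators

/-- The Euclidean (ℓ²) norm of a vector. -/
noncomputable def l2 {n : ℕ} (x : Fin n → ℂ) : ℝ := Real.sqrt (∑ i, ‖x i‖ ^ 2)

/-- The ℓ¹ norm of a vector. -/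
noncomputable def l1 {n : ℕ} (x : Fin n → ℂ) : ℝ := ∑ i, ‖x i‖

/-- `x` has at most `s` nonzero entries. -/
def Sparse {n : ℕ} (s : ℕ) (x : Fin n → ℂ) : Prop :=
  ∃ T : Finset (Fin n), T.card ≤ s ∧ ∀ i ∉ T, x i = 0

/-- `A` satisfies the restricted isometry property with parameters `(s, δ)`. -/
def RIP {m d : ℕ} (A : Matrix (Fin m) (Fin d) ℂ) (s : ℕ) (δ : ℝ) : Prop :=
  ∀ x : Fin d → ℂ, Sparse s x →
    (1 - δ) * (l2 x) ^ 2 ≤ (l2 (A.mulVec x)) ^ 2 ∧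
      (l2 (A.mulVec x)) ^ 2 ≤ (1 + δ) * (l2 x) ^ 2

/-- The spectral norm `‖M‖₂` of a matrix. -/
noncomputable def specNorm {m d : ℕ} (M : Matrix (Fin m) (Fin d) ℂ) : ℝ :=
  sSup {r | ∃ x : Fin d → ℂ, l2 x ≤ 1 ∧ r = l2 (M.mulVec x)}

/-- `‖M‖^{(s)}`: the largest spectral norm over all `s`-column submatrices of `M`,
equivalently the sup of `‖Mx‖₂` over `s`-sparse `x` with `‖x‖₂ ≤ 1`. -/
noncomputable def specNormS {m d : ℕ} (s : ℕ) (M : Matrix (Fin m) (Fin d) ℂ) : ℝ :=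
  sSup {r | ∃ x : Fin d → ℂ, Sparse s x ∧ l2 x ≤ 1 ∧ r = l2 (M.mulVec x)}

/-- `xs` is a best `s`-sparse approximation of `x`: it keeps `s` entries of `x` of
largest magnitude (all entries if `x` has fewer than `s` coordinates) and sets the
others to zero. -/
def IsSparseApprox {n : ℕ} (s : ℕ) (x xs : Fin n → ℂ) : Prop :=
  ∃ T : Finset (Fin n), T.card = min s n ∧
    (∀ i, xs i = if i ∈ T then x i else 0) ∧
    ∀ i ∈ T, ∀ j ∉ T, ‖x j‖ ≤ ‖x i‖

theorem l2_eq_norm_toLp {n : ℕ} (x : Fin n → ℂ) : l2 x = ‖WithLp.toLp 2 x‖ := by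
  simp [l2, EuclideanSpace.norm_eq]

theorem l2_nonneg {n : ℕ} (x : Fin n → ℂ) : 0 ≤ l2 x := Real.sqrt_nonneg _

theorem l2_add_le {n : ℕ} (x y : Fin n → ℂ) : l2 (x + y) ≤ l2 x + l2 y := by
  simpa only [l2_eq_norm_toLp, WithLp.toLp_add] using norm_add_le _ _

theorem l2_neg {n : ℕ} (x : Fin n → ℂ) : l2 (-x) = l2 x := by
  simp [l2]

theorem l2_indicator {n : ℕ} (U : Finset (Fin n)) (z : Fin n → ℂ) :
    l2 ((U : Set (Fin n)).indicator z) = Real.sqrt (∑ i ∈ U, ‖z i‖ ^ 2) := by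
  unfold l2
  congr 1
  rw [← Finset.sum_subset (Finset.subset_univ U)]
  · exact Finset.sum_congr rfl fun i hi => by simp [hi]
  · intro i _ hi
    simp [hi]

theorem Sparse.indicator {n s : ℕ} {U : Finset (Fin n)} (hU : U.card ≤ s) (z : Fin n → ℂ) :
    Sparse s ((U : Set (Fin n)).indicator z) :=
  ⟨U, hU, fun i hi => by simp [hi]⟩

theorem RIP.l2_mulVec_le {m d s : ℕ} {A : Matrix (Fin m) (Fin d) ℂ} {δ : ℝ} (hδ : 0 ≤ δ)
    (h : RIP A s δ) {x : Fin d → ℂ} (hx : Sparse s x) :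
    l2 (A.mulVec x) ≤ Real.sqrt (1 + δ) * l2 x := by
  refine abs_le_of_sq_le_sq' ?_ (by have := l2_nonneg x; positivity) |>.2
  rw [mul_pow, Real.sq_sqrt (by linarith)]
  exact (h x hx).2

theorem RIP.le_l2_mulVec {m d s : ℕ} {A : Matrix (Fin m) (Fin d) ℂ} {δ : ℝ} (hδ : δ < 1)
    (h : RIP A s δ) {x : Fin d → ℂ} (hx : Sparse s x) :
    Real.sqrt (1 - δ) * l2 x ≤ l2 (A.mulVec x) := by
  refine abs_le_of_sq_le_sq' ?_ (l2_nonneg _) |>.2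
  rw [mul_pow, Real.sq_sqrt (by linarith)]
  exact (h x hx).1

theorem Finset.exists_subset_card_eq_forall_le {ι : Type*} [DecidableEq ι] (f : ι → ℝ)
    (U : Finset ι) (k : ℕ) (hk : k ≤ U.card) :
    ∃ T ⊆ U, T.card = k ∧ ∀ i ∈ T, ∀ j ∈ U \ T, f j ≤ f i := by
  induction k with
  | zero => exact ⟨∅, by simp⟩
  | succ k ih =>
    obtain ⟨T, hTU, hTk, hT⟩ := ih (by omega)
    have hne : (U \ T).Nonempty := by
      rw [← Finset.card_pos, Finset.card_sdiff_of_subset hTU]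
      omega
    obtain ⟨a, ha, hmax⟩ := Finset.exists_max_image (U \ T) f hne
    have ha' := Finset.mem_sdiff.1 ha
    refine ⟨insert a T, Finset.insert_subset ha'.1 hTU, by simp [ha'.2, hTk], ?_⟩
    intro i hi j hj
    have hj' : j ∈ U \ T := by
      simp only [Finset.mem_sdiff, Finset.mem_insert, not_or] at hj ⊢
      exact ⟨hj.1, hj.2.2⟩
    rcases Finset.mem_insert.1 hi with rfl | hi
    · exact hmax j hj'
    · exact hT i hi j hj'

/-- The leading block of at most `s` indices of `U`, with a bound `M` for the remaining values
that is at most the average over the block. -/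
theorem Finset.exists_leading_block {ι : Type*} [DecidableEq ι] {f : ι → ℝ} (hf : ∀ i, 0 ≤ f i)
    {s : ℕ} (hs : 1 ≤ s) (U : Finset ι) :
    ∃ T ⊆ U, T.card ≤ s ∧ (U.Nonempty → T.Nonempty) ∧
      ∃ M : ℝ, 0 ≤ M ∧ s * M ≤ ∑ i ∈ T, f i ∧ ∀ j ∈ U \ T, f j ≤ M := by
  rcases le_total U.card s with h | h
  · exact ⟨U, subset_rfl, h, id, 0, le_rfl, by simpa using Finset.sum_nonneg fun i _ => hf i,
      by simp⟩
  · obtain ⟨T, hTU, hTs, hT⟩ := U.exists_subset_card_eq_forall_le f s h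
    have hne : T.Nonempty := by
      rw [← Finset.card_pos]
      omega
    obtain ⟨a, ha, hmin⟩ := Finset.exists_min_image T f hne
    refine ⟨T, hTU, hTs.le, fun _ => hne, f a, hf a, ?_, hT a ha⟩
    simpa [hTs] using Finset.card_nsmul_le_sum T f (f a) hmin

theorem l2_mulVec_indicator_le {m d : ℕ} (A : Matrix (Fin m) (Fin d) ℂ) (z : Fin d → ℂ)
    {T U : Finset (Fin d)} (hTU : T ⊆ U) :
    l2 (A.mulVec ((U : Set (Fin d)).indicator z)) ≤
      l2 (A.mulVec ((T : Set (Fin d)).indicator z)) +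
        l2 (A.mulVec (((U \ T : Finset (Fin d)) : Set (Fin d)).indicator z)) := by
  refine le_of_eq_of_le ?_ (l2_add_le _ _)
  rw [← Matrix.mulVec_add]
  congr 2
  funext i
  by_cases hT : i ∈ T
  · simp [hT, hTU hT]
  · by_cases hU : i ∈ U <;> simp [hT, hU]

theorem mul_sqrt_le_div_sqrt {s M S : ℝ} (hs : 0 < s) (h : s * M ≤ S) :
    Real.sqrt s * M ≤ S / Real.sqrt s := by
  rw [le_div_iff₀ (Real.sqrt_pos.2 hs)]
  rwa [mul_right_comm, Real.mul_self_sqrt hs.le]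

theorem RIP.l2_mulVec_indicator_le_of_forall_le {m d s : ℕ} (hs : 1 ≤ s)
    {A : Matrix (Fin m) (Fin d) ℂ} {δ : ℝ} (hδ : 0 ≤ δ) (h : RIP A s δ) (z : Fin d → ℂ)
    (U : Finset (Fin d)) {M : ℝ} (hM : 0 ≤ M) (hzM : ∀ i ∈ U, ‖z i‖ ≤ M) :
    l2 (A.mulVec ((U : Set (Fin d)).indicator z)) ≤
      Real.sqrt (1 + δ) * (Real.sqrt s * M + (∑ i ∈ U, ‖z i‖) / Real.sqrt s) := by
  induction U using Finset.strongInduction generalizing M with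
  | H U ih =>
  rcases U.eq_empty_or_nonempty with rfl | hU
  · have hzero : l2 (A.mulVec (((∅ : Finset (Fin d)) : Set (Fin d)).indicator z)) = 0 := by
      simp [l2, ← Pi.zero_def]
    rw [hzero]
    positivity
  obtain ⟨T, hTU, hTs, hTne, M', hM', hsum, hle⟩ :=
    Finset.exists_leading_block (fun i => norm_nonneg (z i)) hs U
  have htail := ih (U \ T) (Finset.sdiff_ssubset hTU (hTne hU)) hM' hle
  have hhead := h.l2_mulVec_le hδ (Sparse.indicator hTs z)
  have hblock : l2 ((T : Set (Fin d)).indicator z) ≤ Real.sqrt s * M := by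
    rw [l2_indicator, Real.sqrt_le_left (by positivity), mul_pow, Real.sq_sqrt (by positivity)]
    calc ∑ i ∈ T, ‖z i‖ ^ 2 ≤ ∑ i ∈ T, M ^ 2 :=
          Finset.sum_le_sum fun i hi => pow_le_pow_left₀ (norm_nonneg _) (hzM i (hTU hi)) 2
      _ = T.card * M ^ 2 := by simp
      _ ≤ s * M ^ 2 := by gcongr
  have hsplit := l2_mulVec_indicator_le A z hTU
  have hblockM := mul_sqrt_le_div_sqrt (by positivity : (0 : ℝ) < s) hsum
  calc _ ≤ _ := hsplit
    _ ≤ Real.sqrt (1 + δ) * (Real.sqrt s * M) + Real.sqrt (1 + δ) *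
          ((∑ i ∈ T, ‖z i‖) / Real.sqrt s + (∑ i ∈ U \ T, ‖z i‖) / Real.sqrt s) := by
        refine add_le_add (hhead.trans ?_) (htail.trans ?_) <;> gcongr
    _ = _ := by
        rw [← Finset.sum_sdiff hTU]
        ring

/-- The upper energy bound for arbitrary signals. -/
theorem RIP.l2_mulVec_le_add {m d s : ℕ} (hs : 1 ≤ s)
    {A : Matrix (Fin m) (Fin d) ℂ} {δ : ℝ} (hδ : 0 ≤ δ) (h : RIP A s δ) (z : Fin d → ℂ) :
    l2 (A.mulVec z) ≤ Real.sqrt (1 + δ) * (l2 z + l1 z / Real.sqrt s) := by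
  obtain ⟨T, hTU, hTs, -, M, hM, hsum, hle⟩ :=
    Finset.exists_leading_block (fun i => norm_nonneg (z i)) hs Finset.univ
  have htail := h.l2_mulVec_indicator_le_of_forall_le hs hδ z _ hM hle
  have hhead := h.l2_mulVec_le hδ (Sparse.indicator hTs z)
  have hblock : l2 ((T : Set (Fin d)).indicator z) ≤ l2 z := by
    rw [l2_indicator]
    exact Real.sqrt_le_sqrt
      (Finset.sum_le_sum_of_subset_of_nonneg hTU fun i _ _ => by positivity)
  have hsplit := l2_mulVec_indicator_le A z hTU
  have hMs := mul_sqrt_le_div_sqrt (by positivity : (0 : ℝ) < s) hsum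
  rw [Finset.coe_univ, Set.indicator_univ] at hsplit
  calc _ ≤ _ := hsplit
    _ ≤ Real.sqrt (1 + δ) * l2 z + Real.sqrt (1 + δ) *
          ((∑ i ∈ T, ‖z i‖) / Real.sqrt s +
            (∑ i ∈ Finset.univ \ T, ‖z i‖) / Real.sqrt s) := by
        refine add_le_add (hhead.trans ?_) (htail.trans ?_) <;> gcongr
    _ = _ := by
        rw [l1, ← Finset.sum_sdiff hTU]
        ring

/-- Lower energy bound for arbitrary signals. -/
theorem lower_energy_bound (m d s : ℕ) (hs : 1 ≤ s)
    (A : Matrix (Fin m) (Fin d) ℂ)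
    (δ : ℝ) (hδ0 : 0 ≤ δ) (hδ1 : δ < 1) (hRIP : RIP A s δ) :
    ∀ x xs : Fin d → ℂ, IsSparseApprox s x xs →
      Real.sqrt (1 - δ) * l2 xs
          - Real.sqrt (1 + δ) * (l2 (x - xs) + l1 (x - xs) / Real.sqrt s)
        ≤ l2 (A.mulVec x) := by
  rintro x xs ⟨T, hTs, hxs, -⟩
  have hsparse : Sparse s xs :=
    ⟨T, hTs.trans_le (min_le_left _ _), fun i hi => by rw [hxs, if_neg hi]⟩
  have hlower := hRIP.le_l2_mulVec hδ1 hsparse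
  have hupper := hRIP.l2_mulVec_le_add hs hδ0 (x - xs)
  have htri := l2_add_le (A.mulVec x) (-A.mulVec (x - xs))
  rw [l2_neg, ← sub_eq_add_neg, ← Matrix.mulVec_sub, sub_sub_cancel] at htri
  linarith
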